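/- Let n ≥ 1, 1 < p ≤ q < ∞, and let w be a weight on ℝⁿ with w ∈ A_{p,q}^*. Then for every s > 1, the function w^{q/s} is locally integrable, w^{1/s} belongs to the class A_{p,q}, and [w^{1/s}]_{A_{p,q}} ≤ s'·[w]_{A_{p,q}^*}^{1/s}, where s' = s/(s−1). -/

import Mathlib

open MeasureTheory Set
open scoped ENNReal

noncomputable section

/-- An axis-parallel cube in `ℝⁿ` (realized as `Fin n → ℝ`) with positive finite side length. -/
def IsCube (n : ℕ) (Q : Set (Fin n → ℝ)) : Prop :=
  ∃ (a : Fin n → ℝ) (h : ℝ), 0 < h ∧ Q = Set.univ.pi fun i => Set.Icc (a i) (a i + h)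

/-- The weak `L^p` quasinorm `sup_{t>0} t · |{x : g x > t}|^{1/p}` of an `ℝ≥0∞`-valued
function on `ℝⁿ`. -/
def wnormE (n : ℕ) (p : ℝ) (g : (Fin n → ℝ) → ℝ≥0∞) : ℝ≥0∞ :=
  ⨆ (t : ℝ) (_ : 0 < t), ENNReal.ofReal t * volume {x | ENNReal.ofReal t < g x} ^ (1 / p)

/-- The Hardy–Littlewood maximal operator: supremum of averages of `|f|` over cubes
containing `x`. -/
def maximalFn (n : ℕ) (f : (Fin n → ℝ) → ℝ) (x : Fin n → ℝ) : ℝ≥0∞ :=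
  ⨆ (Q : Set (Fin n → ℝ)) (_ : IsCube n Q) (_ : x ∈ Q),
    (volume Q)⁻¹ * ∫⁻ y in Q, ENNReal.ofReal |f y|

/-- The fractional maximal operator `M_α`. -/
def fracMaximalFn (n : ℕ) (α : ℝ) (f : (Fin n → ℝ) → ℝ) (x : Fin n → ℝ) : ℝ≥0∞ :=
  ⨆ (Q : Set (Fin n → ℝ)) (_ : IsCube n Q) (_ : x ∈ Q),
    volume Q ^ (α / (n : ℝ)) * ((volume Q)⁻¹ * ∫⁻ y in Q, ENNReal.ofReal |f y|)

/-- The multiplier `A_p^*` characteristic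
`[w]_{A_p^*} = sup_Q (|Q|⁻¹·‖w·χ_Q‖_{L^{1,∞}})·(⨍_Q w^{1-p'})^{p-1}`, with `p' = p/(p-1)`. -/
def ApStarConst (n : ℕ) (p : ℝ) (w : (Fin n → ℝ) → ℝ) : ℝ≥0∞ :=
  ⨆ (Q : Set (Fin n → ℝ)) (_ : IsCube n Q),
    (volume Q)⁻¹ * wnormE n 1 (Q.indicator fun x => ENNReal.ofReal (w x)) *
      ((volume Q)⁻¹ * ∫⁻ x in Q, ENNReal.ofReal (w x ^ (1 - p / (p - 1)))) ^ (p - 1)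

/-- The multiplier `A_{p,q}^*` characteristic
`[w]_{A_{p,q}^*} = sup_Q (|Q|⁻¹·‖w^q·χ_Q‖_{L^{1,∞}})^{1/q}·(⨍_Q w^{-p'})^{1/p'}`,
with `p' = p/(p-1)` and `1/p' = 1 - 1/p`. -/
def ApqStarConst (n : ℕ) (p q : ℝ) (w : (Fin n → ℝ) → ℝ) : ℝ≥0∞ :=
  ⨆ (Q : Set (Fin n → ℝ)) (_ : IsCube n Q),
    ((volume Q)⁻¹ * wnormE n 1 (Q.indicator fun x => ENNReal.ofReal (w x ^ q))) ^ (1 / q) *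
      ((volume Q)⁻¹ * ∫⁻ x in Q, ENNReal.ofReal (w x ^ (-(p / (p - 1))))) ^ (1 - 1 / p)

/-- The Muckenhoupt `A_p` characteristic `[w]_{A_p} = sup_Q (⨍_Q w)·(⨍_Q w^{1-p'})^{p-1}`. -/
def ApConst (n : ℕ) (p : ℝ) (w : (Fin n → ℝ) → ℝ) : ℝ≥0∞ :=
  ⨆ (Q : Set (Fin n → ℝ)) (_ : IsCube n Q),
    ((volume Q)⁻¹ * ∫⁻ x in Q, ENNReal.ofReal (w x)) *
      ((volume Q)⁻¹ * ∫⁻ x in Q, ENNReal.ofReal (w x ^ (1 - p / (p - 1)))) ^ (p - 1)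

/-- The Muckenhoupt `A_{p,q}` characteristic
`[w]_{A_{p,q}} = sup_Q (⨍_Q w^q)^{1/q}·(⨍_Q w^{-p'})^{1/p'}`. -/
def ApqConst (n : ℕ) (p q : ℝ) (w : (Fin n → ℝ) → ℝ) : ℝ≥0∞ :=
  ⨆ (Q : Set (Fin n → ℝ)) (_ : IsCube n Q),
    ((volume Q)⁻¹ * ∫⁻ x in Q, ENNReal.ofReal (w x ^ q)) ^ (1 / q) *
      ((volume Q)⁻¹ * ∫⁻ x in Q, ENNReal.ofReal (w x ^ (-(p / (p - 1))))) ^ (1 - 1 / p)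

lemma weak_int {α : Type*} [MeasurableSpace α] (μ : Measure α) [IsProbabilityMeasure μ]
    (f : α → ℝ) (hf : Measurable f) (hf0 : ∀ x, 0 ≤ f x) (s : ℝ) (hs : 1 < s) (M : ℝ≥0∞)
    (hM : ∀ t : ℝ, 0 < t → ENNReal.ofReal t * μ {x | t < f x} ≤ M) :
    ∫⁻ x, ENNReal.ofReal (f x ^ (1 / s)) ∂μ ≤ ENNReal.ofReal (s / (s - 1)) * M ^ (1 / s) := by
  have hs0 : 0 < s := by linarith
  have hs1 : 0 < s - 1 := by linarith
  have hset : ∀ t : ℝ, 0 < t → {x | t < f x ^ (1 / s)} = {x | t ^ s < f x} := by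
    intro t ht
    ext x
    simp only [mem_ofPred_eq, one_div]
    exact Real.lt_rpow_inv_iff_of_pos ht.le (hf0 x) hs0
  rw [lintegral_eq_lintegral_meas_lt μ (Filter.Eventually.of_forall fun x => Real.rpow_nonneg (hf0 x) _)
    (hf.pow_const _).aemeasurable]
  by_cases hMt : M = ∞
  · have h1 : ENNReal.ofReal (s / (s - 1)) ≠ 0 := by
      simp only [ne_eq, ENNReal.ofReal_eq_zero, not_le]; positivity
    rw [hMt, ENNReal.top_rpow_of_pos (by positivity), ENNReal.mul_top h1]
    exact le_top
  by_cases hM0 : M = 0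
  · refine le_of_eq_of_le ?_ zero_le
    rw [lintegral_eq_zero_iff' ?_]
    · filter_upwards [ae_restrict_mem measurableSet_Ioi] with t ht
      have h2 := hM (t ^ s) (Real.rpow_pos_of_pos ht s)
      rw [hM0, nonpos_iff_eq_zero, mul_eq_zero] at h2
      rw [hset t ht]
      rcases h2 with h2 | h2
      · rw [ENNReal.ofReal_eq_zero] at h2
        exact absurd (Real.rpow_pos_of_pos ht s) (not_lt.2 h2)
      · exact h2
    · have : Antitone fun t : ℝ => μ {x | t < f x ^ (1 / s)} := fun a b hab =>
        measure_mono fun x (hx : b < _) => hab.trans_lt hx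
      exact this.measurable.aemeasurable
  obtain ⟨m, rfl⟩ : ∃ m : ℝ, M = ENNReal.ofReal m := ⟨M.toReal, (ENNReal.ofReal_toReal hMt).symm⟩
  have hm : 0 < m := by
    by_contra h
    exact hM0 (ENNReal.ofReal_eq_zero.2 (not_lt.1 h))
  have hT : 0 < m ^ (1 / s) := Real.rpow_pos_of_pos hm _
  set T := m ^ (1 / s) with hTdef
  have hTs : T ^ s = m := by
    rw [hTdef, ← Real.rpow_mul hm.le, one_div_mul_cancel hs0.ne', Real.rpow_one]
  rw [← Ioc_union_Ioi_eq_Ioi hT.le]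
  refine (lintegral_union_le _ _ _).trans ?_
  have hA : ∫⁻ t in Ioc 0 T, μ {x | t < f x ^ (1 / s)} ≤ ENNReal.ofReal T := by
    calc _ ≤ ∫⁻ t in Ioc 0 T, 1 := lintegral_mono fun t => prob_le_one
      _ = _ := by simp
  have hB : ∫⁻ t in Ioi T, μ {x | t < f x ^ (1 / s)} ≤ ENNReal.ofReal (T / (s - 1)) := by
    calc _ ≤ ∫⁻ t in Ioi T, ENNReal.ofReal (m * t ^ (-s)) := by
          refine setLIntegral_mono' measurableSet_Ioi fun t ht => ?_
          have ht0 : 0 < t := hT.trans ht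
          have hts := Real.rpow_pos_of_pos ht0 s
          rw [hset t ht0, Real.rpow_neg ht0.le, ← div_eq_mul_inv, ENNReal.ofReal_div_of_pos hts,
            ENNReal.le_div_iff_mul_le (by simp [hts]) (by simp), mul_comm]
          exact hM _ hts
      _ = ENNReal.ofReal (∫ t in Ioi T, m * t ^ (-s)) := by
          rw [ofReal_integral_eq_lintegral_ofReal]
          · exact (integrableOn_Ioi_rpow_of_lt (by linarith) hT).const_mul m
          · filter_upwards [ae_restrict_mem measurableSet_Ioi] with t ht
            exact mul_nonneg hm.le (Real.rpow_nonneg (hT.trans ht).le _)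
      _ = _ := by
          rw [integral_const_mul, integral_Ioi_rpow_of_lt (by linarith) hT]
          congr 1
          have : T ^ (-s + 1) = T / m := by
            rw [Real.rpow_add hT, Real.rpow_neg hT.le, hTs, Real.rpow_one]; field_simp
          rw [this]
          have : -s + 1 ≠ 0 := by linarith
          field_simp
          ring
  refine (add_le_add hA hB).trans (le_of_eq ?_)
  rw [ENNReal.ofReal_rpow_of_pos hm, ← ENNReal.ofReal_add hT.le (by positivity),
    ← ENNReal.ofReal_mul (by positivity)]
  congr 1
  field_simp
  ring

lemma jensen_pow {α : Type*} [MeasurableSpace α] (μ : Measure α) [IsProbabilityMeasure μ]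
    (f : α → ℝ≥0∞) (hf : Measurable f) (s : ℝ) (hs : 1 < s) :
    ∫⁻ x, f x ^ (1 / s) ∂μ ≤ (∫⁻ x, f x ∂μ) ^ (1 / s) := by
  have h := ENNReal.lintegral_mul_le_Lp_mul_Lq μ (Real.HolderConjugate.conjExponent hs)
    (f := fun x => f x ^ (1 / s)) (g := fun _ => 1) (hf.pow_const _).aemeasurable
    aemeasurable_const
  have hs0 : s ≠ 0 := by linarith
  simpa [← ENNReal.rpow_mul, inv_mul_cancel₀ hs0] using h

lemma cube_facts {n : ℕ} {Q : Set (Fin n → ℝ)} (hQ : IsCube n Q) :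
    MeasurableSet Q ∧ volume Q ≠ 0 ∧ volume Q ≠ ∞ := by
  obtain ⟨a, h, hh, rfl⟩ := hQ
  refine ⟨MeasurableSet.univ_pi fun i => measurableSet_Icc, ?_, ?_⟩
  · rw [volume_pi_pi, Finset.prod_ne_zero_iff]
    intro i _
    simp [hh]
  · rw [volume_pi_pi]
    exact ENNReal.prod_ne_top fun i _ => by simp

lemma cube_first {n : ℕ} {Q : Set (Fin n → ℝ)} (hQ : IsCube n Q) (q s : ℝ) (hs : 1 < s)
    (w : (Fin n → ℝ) → ℝ) (hwm : Measurable w) (hw0 : ∀ x, 0 ≤ w x) :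
    (volume Q)⁻¹ * ∫⁻ x in Q, ENNReal.ofReal ((w x ^ q) ^ (1 / s)) ≤
      ENNReal.ofReal (s / (s - 1)) * ((volume Q)⁻¹ *
        wnormE n 1 (Q.indicator fun x => ENNReal.ofReal (w x ^ q))) ^ (1 / s) := by
  obtain ⟨hm, h0, ht⟩ := cube_facts hQ
  have : IsProbabilityMeasure ((volume Q)⁻¹ • volume.restrict Q) :=
    ⟨by simp [ENNReal.inv_mul_cancel h0 ht]⟩
  have h := weak_int ((volume Q)⁻¹ • volume.restrict Q) (fun x => w x ^ q) (hwm.pow_const _)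
    (fun x => Real.rpow_nonneg (hw0 x) _) s hs ((volume Q)⁻¹ *
        wnormE n 1 (Q.indicator fun x => ENNReal.ofReal (w x ^ q))) (by
    intro t ht
    rw [Measure.smul_apply, smul_eq_mul, mul_left_comm]
    gcongr
    refine le_trans ?_ (le_iSup₂ (f := fun (t : ℝ) (_ : 0 < t) => ENNReal.ofReal t *
      volume {x | ENNReal.ofReal t < Q.indicator (fun x => ENNReal.ofReal (w x ^ q)) x} ^
        (1 / (1 : ℝ))) t ht)
    simp only [div_one, ENNReal.rpow_one]
    rw [Measure.restrict_apply' hm]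
    refine mul_le_mul' le_rfl (measure_mono fun x hx => by
      have h1 : t < w x ^ q := hx.1
      simp only [mem_ofPred_eq, indicator_of_mem hx.2]
      exact (ENNReal.ofReal_lt_ofReal_iff (ht.trans h1)).2 h1))
  rwa [lintegral_smul_measure, smul_eq_mul] at h

lemma cube_second {n : ℕ} {Q : Set (Fin n → ℝ)} (hQ : IsCube n Q) (s : ℝ) (hs : 1 < s)
    (g : (Fin n → ℝ) → ℝ≥0∞) (hg : Measurable g) :
    (volume Q)⁻¹ * ∫⁻ x in Q, g x ^ (1 / s) ≤ ((volume Q)⁻¹ * ∫⁻ x in Q, g x) ^ (1 / s) := by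
  obtain ⟨hm, h0, ht⟩ := cube_facts hQ
  have : IsProbabilityMeasure ((volume Q)⁻¹ • volume.restrict Q) :=
    ⟨by simp [ENNReal.inv_mul_cancel h0 ht]⟩
  have h := jensen_pow ((volume Q)⁻¹ • volume.restrict Q) g hg s hs
  rwa [lintegral_smul_measure, smul_eq_mul, lintegral_smul_measure, smul_eq_mul] at h

/-- If `1 < p ≤ q < ∞` and `w ∈ A_{p,q}^*`, then for every `s > 1` the
function `w^{q/s}` is locally integrable, `w^{1/s}` belongs to `A_{p,q}`, and
`[w^{1/s}]_{A_{p,q}} ≤ s'·[w]_{A_{p,q}^*}^{1/s}` with `s' = s/(s-1)`. -/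
theorem statement9 (n : ℕ) (hn : 1 ≤ n) (p q : ℝ) (hp : 1 < p) (hpq : p ≤ q)
    (w : (Fin n → ℝ) → ℝ) (hwm : Measurable w) (hw0 : ∀ x, 0 ≤ w x)
    (hwpos : ∀ᵐ x ∂(volume : Measure (Fin n → ℝ)), 0 < w x)
    (hw : ApqStarConst n p q w < ∞) :
    ∀ s : ℝ, 1 < s →
      LocallyIntegrable (fun x => w x ^ (q / s)) (volume : Measure (Fin n → ℝ)) ∧
      ApqConst n p q (fun x => w x ^ (1 / s)) < ∞ ∧
      ApqConst n p q (fun x => w x ^ (1 / s)) ≤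
        ENNReal.ofReal (s / (s - 1)) * ApqStarConst n p q w ^ (1 / s) := by
  intro s hs
  have hs0 : 0 < s := by linarith
  have hs1 : 0 < s - 1 := by linarith
  have hq : 0 < q := by linarith
  have hp' : 0 < 1 - 1 / p := by
    have : 1 / p < 1 := by rw [div_lt_one] <;> linarith
    linarith
  have hbound : ApqConst n p q (fun x => w x ^ (1 / s)) ≤
        ENNReal.ofReal (s / (s - 1)) * ApqStarConst n p q w ^ (1 / s) := by
    refine iSup₂_le fun Q hQ => ?_
    have h1 := cube_first hQ q s hs w hwm hw0
    have h2 := cube_second hQ s hs (fun x => ENNReal.ofReal (w x ^ (-(p / (p - 1)))))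
      (hwm.pow_const _).ennreal_ofReal
    have e1 : ∀ x, (w x ^ (1 / s)) ^ q = (w x ^ q) ^ (1 / s) := fun x => by
      rw [← Real.rpow_mul (hw0 x), ← Real.rpow_mul (hw0 x), mul_comm]
    have e2 : ∀ x, ENNReal.ofReal ((w x ^ (1 / s)) ^ (-(p / (p - 1)))) =
        ENNReal.ofReal (w x ^ (-(p / (p - 1)))) ^ (1 / s) := fun x => by
      rw [ENNReal.ofReal_rpow_of_nonneg (Real.rpow_nonneg (hw0 x) _) (by positivity),
        ← Real.rpow_mul (hw0 x), ← Real.rpow_mul (hw0 x), mul_comm]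
    simp only [e1, e2]
    have h3 := le_iSup₂ (f := fun (Q : Set (Fin n → ℝ)) (_ : IsCube n Q) =>
      ((volume Q)⁻¹ * wnormE n 1 (Q.indicator fun x => ENNReal.ofReal (w x ^ q))) ^ (1 / q) *
      ((volume Q)⁻¹ * ∫⁻ x in Q, ENNReal.ofReal (w x ^ (-(p / (p - 1))))) ^ (1 - 1 / p)) Q hQ
    have hs' : 1 ≤ ENNReal.ofReal (s / (s - 1)) := by
      rw [ENNReal.one_le_ofReal, le_div_iff₀ hs1]; linarith
    refine (mul_le_mul' (ENNReal.rpow_le_rpow h1 (by positivity : 0 ≤ 1 / q))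
      (ENNReal.rpow_le_rpow h2 hp'.le)).trans ?_
    rw [ENNReal.mul_rpow_of_nonneg _ _ (by positivity), mul_assoc]
    refine mul_le_mul' ?_ ?_
    · calc _ ≤ ENNReal.ofReal (s / (s - 1)) ^ (1 : ℝ) :=
            ENNReal.rpow_le_rpow_of_exponent_le hs' (by rw [div_le_one hq]; linarith)
        _ = _ := ENNReal.rpow_one _
    · refine le_trans (le_of_eq ?_) (ENNReal.rpow_le_rpow h3 (by positivity : 0 ≤ 1 / s))
      generalize (volume Q)⁻¹ * wnormE n 1 (Q.indicator fun x => ENNReal.ofReal (w x ^ q)) = A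
      generalize (volume Q)⁻¹ * ∫⁻ x in Q, ENNReal.ofReal (w x ^ (-(p / (p - 1)))) = B
      rw [ENNReal.mul_rpow_of_nonneg _ _ (by positivity)]
      simp only [← ENNReal.rpow_mul]
      rw [mul_comm (1 / s) (1 / q), mul_comm (1 / s) (1 - 1 / p)]
  refine ⟨?_, ?_, hbound⟩
  · intro x
    have hQ : IsCube n (Set.univ.pi fun i => Set.Icc (x i - 1) (x i - 1 + 2)) :=
      ⟨fun i => x i - 1, 2, two_pos, rfl⟩
    refine ⟨_, set_pi_mem_nhds (i := univ) finite_univ (fun i _ => Icc_mem_nhds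
      (by linarith : x i - 1 < x i) (by linarith : x i < x i - 1 + 2)), ?_⟩
    set Q := Set.univ.pi fun i => Set.Icc (x i - 1) (x i - 1 + 2)
    obtain ⟨hm, h0, ht⟩ := cube_facts hQ
    have h1 := cube_first hQ q s hs w hwm hw0
    have h3 := (le_iSup₂ (f := fun (Q : Set (Fin n → ℝ)) (_ : IsCube n Q) =>
      ((volume Q)⁻¹ * wnormE n 1 (Q.indicator fun x => ENNReal.ofReal (w x ^ q))) ^ (1 / q) *
      ((volume Q)⁻¹ * ∫⁻ x in Q, ENNReal.ofReal (w x ^ (-(p / (p - 1))))) ^ (1 - 1 / p))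
        Q hQ).trans_lt hw
    have hI : ∫⁻ x in Q, ENNReal.ofReal (w x ^ (-(p / (p - 1)))) ≠ 0 := by
      intro h
      rw [lintegral_eq_zero_iff (hwm.pow_const _).ennreal_ofReal] at h
      have hf : ∀ᵐ x ∂(volume.restrict Q), False := by
        filter_upwards [h, ae_restrict_of_ae hwpos] with y hy hy'
        rw [Pi.zero_apply, ENNReal.ofReal_eq_zero] at hy
        exact absurd (Real.rpow_pos_of_pos hy' _) (not_lt.2 hy)
      rw [Filter.eventually_false_iff_eq_bot, ae_eq_bot, Measure.restrict_eq_zero] at hf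
      exact h0 hf
    have hM : (volume Q)⁻¹ * wnormE n 1 (Q.indicator fun x => ENNReal.ofReal (w x ^ q)) ≠ ∞ := by
      intro h
      simp only [h] at h3
      rw [ENNReal.top_rpow_of_pos (by positivity), ENNReal.top_mul] at h3
      · exact lt_irrefl _ h3
      · simp only [ne_eq, ENNReal.rpow_eq_zero_iff_of_pos hp', mul_eq_zero, hI, or_false,
          ENNReal.inv_eq_zero, ht, not_false_eq_true]
    have h4 : (volume Q)⁻¹ * ∫⁻ x in Q, ENNReal.ofReal ((w x ^ q) ^ (1 / s)) < ∞ :=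
      h1.trans_lt (ENNReal.mul_lt_top ENNReal.ofReal_lt_top
        (ENNReal.rpow_lt_top_of_nonneg (by positivity) hM))
    have h5 : ∫⁻ x in Q, ENNReal.ofReal ((w x ^ q) ^ (1 / s)) < ∞ := by
      rw [lt_top_iff_ne_top]
      intro h
      rw [h, ENNReal.mul_top (by simpa using ht)] at h4
      exact lt_irrefl _ h4
    refine ⟨(hwm.pow_const _).aestronglyMeasurable, ?_⟩
    rw [hasFiniteIntegral_iff_ofReal (Filter.Eventually.of_forall fun y =>
      Real.rpow_nonneg (hw0 y) _)]
    have e : ∀ y, w y ^ (q / s) = (w y ^ q) ^ (1 / s) := fun y => by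
      rw [← Real.rpow_mul (hw0 y), mul_one_div]
    simpa only [e] using h5
  · exact hbound.trans_lt (ENNReal.mul_lt_top ENNReal.ofReal_lt_top
      (ENNReal.rpow_lt_top_of_nonneg (by positivity) hw.ne))
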